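/- Let φ₁: Mₙ(ℂ) → Mₙ(ℂ) be an invertible unital q-positive map and φ₂: Mₙ(ℂ) → Mₙ(ℂ) linear and invertible. Then φ₁ ≥_q φ₂ ≥_q 0 if and only if φ₂⁻¹ is conditionally negative and φ₂⁻¹ − φ₁⁻¹ is completely positive. -/

import Mathlib

open scoped ComplexOrder BigOperators
open Matrix

abbrev MatC (n : ℕ) := Matrix (Fin n) (Fin n) ℂ

/-- Complete positivity of a linear map on `Mₙ(ℂ)`:
for all finite families `Aᵢ`, `fᵢ`, `∑ ⟨fᵢ, φ(Aᵢ* Aⱼ) fⱼ⟩ ≥ 0`. -/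
def IsCP {n : ℕ} (φ : Module.End ℂ (MatC n)) : Prop :=
  ∀ (m : ℕ) (A : Fin m → MatC n) (f : Fin m → (Fin n → ℂ)),
    0 ≤ ∑ i, ∑ j, star (f i) ⬝ᵥ ((φ ((A i)ᴴ * A j)) *ᵥ f j)

/-- `φ` has no negative (real) eigenvalues. -/
def NoNegEig {n : ℕ} (φ : Module.End ℂ (MatC n)) : Prop :=
  ∀ r : ℝ, r < 0 → ¬ Module.End.HasEigenvalue φ (r : ℂ)

/-- `φ^(t) = φ ∘ (I + t φ)⁻¹`. -/
noncomputable def qRes {n : ℕ} (φ : Module.End ℂ (MatC n)) (t : ℝ) :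
    Module.End ℂ (MatC n) :=
  φ * Ring.inverse (1 + (t : ℂ) • φ)

/-- `φ` is q-positive. -/
def IsQPos {n : ℕ} (φ : Module.End ℂ (MatC n)) : Prop :=
  NoNegEig φ ∧ ∀ t : ℝ, 0 ≤ t → IsCP (qRes φ t)

/-- `φ ≥_q ψ` : `φ(I+tφ)⁻¹ − ψ(I+tψ)⁻¹` is completely positive for all `t ≥ 0`. -/
def qLE {n : ℕ} (ψ φ : Module.End ℂ (MatC n)) : Prop :=
  ∀ t : ℝ, 0 ≤ t → IsCP (qRes φ t - qRes ψ t)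

/-- `φ` is q-pure: its q-subordinates are exactly `{0} ∪ {φ^(s) : s ≥ 0}`. -/
def IsQPure {n : ℕ} (φ : Module.End ℂ (MatC n)) : Prop :=
  IsQPos φ ∧ ∀ ψ : Module.End ℂ (MatC n),
    (IsQPos ψ ∧ qLE ψ φ) ↔ (ψ = 0 ∨ ∃ s : ℝ, 0 ≤ s ∧ ψ = qRes φ s)

/-- `ψ` is self-adjoint as a map: `ψ(A*) = ψ(A)*`. -/
def SelfAdjMap {n : ℕ} (ψ : Module.End ℂ (MatC n)) : Prop := ∀ A : MatC n, ψ Aᴴ = (ψ A)ᴴ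

/-- Conditionally negative map on `Mₙ(ℂ)`. -/
def IsCondNeg {n : ℕ} (ψ : Module.End ℂ (MatC n)) : Prop :=
  SelfAdjMap ψ ∧
  ∀ (m : ℕ) (A : Fin m → MatC n) (f : Fin m → (Fin n → ℂ)),
    (∑ i, (A i) *ᵥ f i) = 0 →
    ∑ i, ∑ j, star (f i) ⬝ᵥ ((ψ ((A i)ᴴ * A j)) *ᵥ f j) ≤ 0

open scoped MatrixOrder Matrix.Norms.L2Operator
open Filter Topology

section helpers

variable {n : ℕ}

/-- The sesquilinear form of a family, as a linear functional of the map. -/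
noncomputable def formL {m : ℕ} (A : Fin m → MatC n) (f : Fin m → (Fin n → ℂ)) :
    Module.End ℂ (MatC n) →ₗ[ℂ] ℂ where
  toFun φ := ∑ i, ∑ j, star (f i) ⬝ᵥ ((φ ((A i)ᴴ * A j)) *ᵥ f j)
  map_add' φ ψ := by
    simp [Matrix.add_mulVec, dotProduct_add, Finset.sum_add_distrib]
  map_smul' c φ := by
    simp [Matrix.smul_mulVec, dotProduct_smul, Finset.mul_sum]

theorem formL_apply {m : ℕ} (A : Fin m → MatC n) (f : Fin m → (Fin n → ℂ))
    (φ : Module.End ℂ (MatC n)) :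
    formL A f φ = ∑ i, ∑ j, star (f i) ⬝ᵥ ((φ ((A i)ᴴ * A j)) *ᵥ f j) := rfl

theorem isCP_iff (φ : Module.End ℂ (MatC n)) :
    IsCP φ ↔ ∀ (m : ℕ) (A : Fin m → MatC n) (f : Fin m → (Fin n → ℂ)), 0 ≤ formL A f φ :=
  Iff.rfl

theorem star_quad {k : Type*} [Fintype k] (u v : k → ℂ) (M : Matrix k k ℂ) :
    star (star u ⬝ᵥ (M *ᵥ v)) = star v ⬝ᵥ (Mᴴ *ᵥ u) := by
  rw [Matrix.star_dotProduct, star_star, Matrix.star_mulVec, ← Matrix.dotProduct_mulVec]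

theorem posSemidef_of_quad {k : Type*} [Fintype k] [DecidableEq k] (M : Matrix k k ℂ)
    (h : ∀ v : k → ℂ, 0 ≤ star v ⬝ᵥ (M *ᵥ v)) : M.PosSemidef := by
  rw [← Matrix.isPositive_toEuclideanLin_iff, LinearMap.isPositive_iff_complex]
  intro x
  have h' := h x.ofLp
  have e : inner ℂ (M.toEuclideanLin x) x = star (star x.ofLp ⬝ᵥ (M *ᵥ x.ofLp)) := by
    rw [EuclideanSpace.inner_eq_star_dotProduct, dotProduct_comm, Matrix.star_dotProduct]
    simp [dotProduct_comm]
  rw [e]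
  have := Complex.le_def.1 h'
  constructor
  · apply Complex.ext <;> simp [← this.2]
  · simpa using this.1

theorem IsCP.nonneg {φ : Module.End ℂ (MatC n)} (h : IsCP φ) {a : MatC n} (ha : 0 ≤ a) :
    0 ≤ φ a := by
  obtain ⟨b, rfl⟩ := CStarAlgebra.nonneg_iff_eq_star_mul_self.mp ha
  rw [Matrix.nonneg_iff_posSemidef]
  apply posSemidef_of_quad
  intro v
  simpa [Matrix.star_eq_conjTranspose] using h 1 (fun _ => b) (fun _ => v)

theorem end_induction {p : MatC n → Prop} (hn : ∀ a, 0 ≤ a → p a)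
    (hadd : ∀ a b, p a → p b → p (a + b)) (hs : ∀ (c : ℂ) a, p a → p (c • a)) (a : MatC n) :
    p a := by
  have : a ∈ Submodule.span ℂ {a : MatC n | 0 ≤ a} := by
    rw [CStarAlgebra.span_nonneg]; trivial
  induction this using Submodule.span_induction with
  | mem x h => exact hn x h
  | zero => exact hn 0 le_rfl
  | add x y _ _ hx hy => exact hadd x y hx hy
  | smul c x _ hx => exact hs c x hx

theorem IsCP.selfAdj {φ : Module.End ℂ (MatC n)} (h : IsCP φ) : SelfAdjMap φ := by
  intro a
  induction a using end_induction with
  | hn a ha =>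
    have h1 : aᴴ = a := (Matrix.nonneg_iff_posSemidef.1 ha).isHermitian
    have h2 : (φ a)ᴴ = φ a := (Matrix.nonneg_iff_posSemidef.1 (h.nonneg ha)).isHermitian
    rw [h1, h2]
  | hadd a b ha hb => simp [ha, hb]
  | hs c a ha => simp [ha]

theorem IsCP.add {φ ψ : Module.End ℂ (MatC n)} (h : IsCP φ) (h' : IsCP ψ) : IsCP (φ + ψ) := by
  rw [isCP_iff] at *
  intro m A f
  rw [map_add]
  exact add_nonneg (h m A f) (h' m A f)

theorem IsCP.smul {φ : Module.End ℂ (MatC n)} (h : IsCP φ) {c : ℂ} (hc : 0 ≤ c) :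
    IsCP (c • φ) := by
  rw [isCP_iff] at *
  intro m A f
  rw [map_smul]
  exact mul_nonneg hc (h m A f)

theorem formL_conj {m : ℕ} (A : Fin m → MatC n) (f : Fin m → (Fin n → ℂ)) (B : MatC n) :
    formL A f (LinearMap.mulLeft ℂ B * LinearMap.mulRight ℂ Bᴴ) =
      star (∑ i, A i *ᵥ (Bᴴ *ᵥ f i)) ⬝ᵥ (∑ i, A i *ᵥ (Bᴴ *ᵥ f i)) := by
  rw [formL_apply, star_sum, sum_dotProduct]
  refine Finset.sum_congr rfl fun i _ => ?_
  rw [dotProduct_sum]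
  refine Finset.sum_congr rfl fun j _ => ?_
  simp [Matrix.star_mulVec, Matrix.dotProduct_mulVec, Matrix.vecMul_vecMul, Matrix.mul_assoc]

theorem IsCP.conj (B : MatC n) :
    IsCP (LinearMap.mulLeft ℂ B * LinearMap.mulRight ℂ Bᴴ) := by
  rw [isCP_iff]
  intro m A f
  rw [formL_conj]
  exact dotProduct_star_self_nonneg _

theorem formL_one {m : ℕ} (A : Fin m → MatC n) (f : Fin m → (Fin n → ℂ)) :
    formL A f 1 = star (∑ i, A i *ᵥ f i) ⬝ᵥ (∑ i, A i *ᵥ f i) := by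
  have := formL_conj A f 1
  simp only [conjTranspose_one, LinearMap.mulLeft_one, LinearMap.mulRight_one, one_mulVec] at this
  exact this

theorem IsCP.one : IsCP (1 : Module.End ℂ (MatC n)) := by
  rw [isCP_iff]
  intro m A f
  rw [formL_one]
  exact dotProduct_star_self_nonneg _

theorem IsCP.mul {φ ψ : Module.End ℂ (MatC n)} (h : IsCP φ) (h' : IsCP ψ) : IsCP (φ * ψ) := by
  intro m A f
  let M : Matrix (Fin m × Fin n) (Fin m × Fin n) ℂ :=
    Matrix.of fun p q => ψ ((A p.1)ᴴ * A q.1) p.2 q.2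
  have hM : M.PosSemidef := by
    apply posSemidef_of_quad
    intro v
    convert h' m A (fun i a => v (i, a)) using 1
    simp only [M, dotProduct, mulVec, Fintype.sum_prod_type, Matrix.of_apply, Pi.star_apply,
      Finset.mul_sum]
    refine Finset.sum_congr rfl fun i _ => ?_
    rw [Finset.sum_comm]
  obtain ⟨C, hC⟩ := CStarAlgebra.nonneg_iff_eq_star_mul_self.mp
    (Matrix.nonneg_iff_posSemidef.2 hM)
  let B : Fin m → Fin m → MatC n := fun k i => Matrix.of fun a b => C (k, a) (i, b)
  have hB : ∀ i j, ψ ((A i)ᴴ * A j) = ∑ k, (B k i)ᴴ * B k j := by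
    intro i j
    ext a b
    have := congrFun (congrFun hC (i, a)) (j, b)
    simp only [M, Matrix.of_apply] at this
    rw [this]
    simp [Matrix.mul_apply, Fintype.sum_prod_type, B, Matrix.sum_apply, Matrix.star_apply]
  have : ∑ i, ∑ j, star (f i) ⬝ᵥ (((φ * ψ) ((A i)ᴴ * A j)) *ᵥ f j)
      = ∑ k, ∑ i, ∑ j, star (f i) ⬝ᵥ ((φ ((B k i)ᴴ * B k j)) *ᵥ f j) := by
    rw [Finset.sum_comm]
    simp_rw [Module.End.mul_apply, hB, map_sum, Matrix.sum_mulVec, dotProduct_sum]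
    rw [Finset.sum_comm]
    conv_rhs => rw [Finset.sum_comm]
    refine Finset.sum_congr rfl fun i _ => ?_
    rw [Finset.sum_comm]
  rw [this]
  exact Finset.sum_nonneg fun k _ => h m (B k) f

theorem IsCP.pow {φ : Module.End ℂ (MatC n)} (h : IsCP φ) (k : ℕ) : IsCP (φ ^ k) := by
  induction k with
  | zero => exact IsCP.one
  | succ k ih => rw [pow_succ]; exact ih.mul h

theorem IsCP.sum {ι : Type*} (s : Finset ι) {φ : ι → Module.End ℂ (MatC n)}
    (h : ∀ i, IsCP (φ i)) : IsCP (∑ i ∈ s, φ i) := by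
  rw [isCP_iff]
  intro m A f
  rw [map_sum]
  exact Finset.sum_nonneg fun k _ => h k m A f

theorem tendsto_formL {m : ℕ} (A : Fin m → MatC n) (f : Fin m → (Fin n → ℂ)) {ι : Type*}
    {l : Filter ι} {φ : ι → Module.End ℂ (MatC n)} {ψ : Module.End ℂ (MatC n)}
    (h : ∀ X, Tendsto (fun k => φ k X) l (𝓝 (ψ X))) :
    Tendsto (fun k => formL A f (φ k)) l (𝓝 (formL A f ψ)) := by
  simp only [formL_apply]
  refine tendsto_finsetSum _ fun i _ => tendsto_finsetSum _ fun j _ => ?_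
  have hc : Continuous fun X : MatC n => star (f i) ⬝ᵥ (X *ᵥ f j) := by fun_prop
  exact (hc.tendsto _).comp (h _)

theorem IsCP.of_tendsto {ι : Type*} {l : Filter ι} [l.NeBot]
    {φ : ι → Module.End ℂ (MatC n)} {ψ : Module.End ℂ (MatC n)}
    (h : ∀ X, Tendsto (fun k => φ k X) l (𝓝 (ψ X))) (hcp : ∀ᶠ k in l, IsCP (φ k)) : IsCP ψ := by
  rw [isCP_iff]
  intro m A f
  exact ge_of_tendsto (tendsto_formL A f h) (hcp.mono fun k hk => hk m A f)

/-- If `S` is completely positive and `S 1 ≤ δ < 1` then `1 - S` is invertible with completely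
positive inverse. -/
theorem neumann {S : Module.End ℂ (MatC n)} (hS : IsCP S) {δ : ℝ} (h0 : 0 ≤ δ) (h1 : δ < 1)
    (hle : S 1 ≤ δ • (1 : MatC n)) : ∃ R : Module.End ℂ (MatC n), (1 - S) * R = 1 ∧
      R * (1 - S) = 1 ∧ IsCP R := by
  have mono : ∀ (k : ℕ) {a b : MatC n}, a ≤ b → (S ^ k) a ≤ (S ^ k) b := by
    intro k a b hab
    rw [← sub_nonneg, ← map_sub]
    exact (hS.pow k).nonneg (sub_nonneg.2 hab)
  have hsm : ∀ (φ : Module.End ℂ (MatC n)) (r : ℝ) (a : MatC n), φ (r • a) = r • φ a := by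
    intro φ r a
    exact LinearMap.map_smul_of_tower φ r a
  have hpow : ∀ k : ℕ, (S ^ k) 1 ≤ (δ ^ k) • (1 : MatC n) := by
    intro k
    induction k with
    | zero => simp
    | succ k ih =>
      rw [pow_succ, Module.End.mul_apply]
      refine (mono k hle).trans ?_
      rw [hsm, pow_succ', mul_smul]
      exact smul_le_smul_of_nonneg_left ih h0
  have hlim : ∀ X : MatC n, Tendsto (fun k => (S ^ k) X) atTop (𝓝 0) := by
    intro X
    induction X using end_induction with
    | hn a ha =>
      have hb : ∀ k, ‖(S ^ k) a‖ ≤ ‖a‖ * δ ^ k := by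
        intro k
        rw [CStarAlgebra.norm_le_iff_le_algebraMap _ (by positivity) ((hS.pow k).nonneg ha)]
        have : a ≤ ‖a‖ • (1 : MatC n) := by
          have := IsSelfAdjoint.le_algebraMap_norm_self (IsSelfAdjoint.of_nonneg ha)
          rwa [Algebra.algebraMap_eq_smul_one] at this
        refine (mono k this).trans ?_
        rw [hsm, Algebra.algebraMap_eq_smul_one, mul_smul]
        exact smul_le_smul_of_nonneg_left (hpow k) (norm_nonneg _)
      refine squeeze_zero_norm hb ?_
      simpa using (tendsto_pow_atTop_nhds_zero_of_lt_one h0 h1).const_mul ‖a‖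
    | hadd a b ha hb => simpa using ha.add hb
    | hs c a ha => simpa using ha.const_smul c
  have hinj : Function.Injective (1 - S : Module.End ℂ (MatC n)) := by
    rw [injective_iff_map_eq_zero]
    intro x hx
    have hx' : S x = x := by
      have hx2 : x - S x = 0 := hx
      exact (sub_eq_zero.1 hx2).symm
    have hk : ∀ k : ℕ, (S ^ k) x = x := by
      intro k
      induction k with
      | zero => simp
      | succ k ih => rw [pow_succ, Module.End.mul_apply, hx', ih]
    have := hlim x
    simp only [hk] at this
    exact tendsto_nhds_unique tendsto_const_nhds this
  have hu : IsUnit (1 - S) := (LinearMap.isUnit_iff_ker_eq_bot _).2 (LinearMap.ker_eq_bot.2 hinj)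
  obtain ⟨u, hu⟩ := hu
  refine ⟨(↑u⁻¹ : Module.End ℂ (MatC n)), by rw [← hu]; simp, by rw [← hu]; simp, ?_⟩
  refine IsCP.of_tendsto (l := atTop) (φ := fun k : ℕ => ∑ j ∈ Finset.range k, S ^ j) ?_
    (Eventually.of_forall fun k => IsCP.sum _ fun j => hS.pow j)
  intro X
  have e : ∀ k : ℕ, ∑ j ∈ Finset.range k, S ^ j
      = (↑u⁻¹ : Module.End ℂ (MatC n)) * (1 - S ^ k) := by
    intro k
    rw [← mul_neg_geom_sum, ← hu]
    simp
  simp only [e, Module.End.mul_apply]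
  have hc : Continuous (↑u⁻¹ : Module.End ℂ (MatC n)) := LinearMap.continuous_of_finiteDimensional _
  refine (hc.tendsto X).comp ?_
  simpa using tendsto_const_nhds.sub (hlim X)

theorem formL_mulRight {m : ℕ} (A : Fin m → MatC n) (f : Fin m → (Fin n → ℂ)) (G : MatC n) :
    formL A f (LinearMap.mulRight ℂ Gᴴ) = star (formL A f (LinearMap.mulLeft ℂ G)) := by
  rw [formL_apply, formL_apply, Finset.sum_comm, star_sum]
  refine Finset.sum_congr rfl fun i _ => ?_
  rw [star_sum]
  refine Finset.sum_congr rfl fun j _ => ?_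
  rw [star_quad]
  simp [Matrix.mul_assoc]

/-- Lindblad-type decomposition of a conditionally negative map. -/
theorem lindblad {ψ : Module.End ℂ (MatC n)} (hψ : IsCondNeg ψ) :
    ∃ (G : MatC n) (g : ℝ),
      IsCP (LinearMap.mulLeft ℂ G + LinearMap.mulRight ℂ Gᴴ - (g : ℂ) • 1 - ψ) := by
  obtain rfl | hn := Nat.eq_zero_or_pos n
  · refine ⟨0, 0, ?_⟩
    intro m A f
    simp [dotProduct]
  obtain ⟨hsa, hneg⟩ := hψ
  let e : Fin n → ℂ := Pi.single ⟨0, hn⟩ 1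
  have he : star e ⬝ᵥ e = 1 := by simp [e]
  let L : (Fin n → ℂ) →ₗ[ℂ] (Fin n → ℂ) :=
    { toFun := fun y => ψ (vecMulVec y (star e)) *ᵥ e
      map_add' := fun x y => by simp [add_vecMulVec, add_mulVec]
      map_smul' := fun c x => by simp [smul_vecMulVec, smul_mulVec] }
  let G : MatC n := LinearMap.toMatrix' L
  have hG : ∀ y, G *ᵥ y = ψ (vecMulVec y (star e)) *ᵥ e := fun y =>
    LinearMap.toMatrix'_mulVec L y
  let γ : ℂ := star e ⬝ᵥ (ψ (vecMulVec e (star e)) *ᵥ e)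
  have hγ : ((γ.re : ℝ) : ℂ) = γ := by
    rw [← Complex.conj_eq_iff_re]
    change star γ = γ
    simp only [γ]
    rw [star_quad, ← hsa]
    simp [conjTranspose_vecMulVec]
  refine ⟨G, γ.re, ?_⟩
  rw [isCP_iff]
  intro m A f
  set x : Fin n → ℂ := ∑ i, A i *ᵥ f i with hx
  let A0 : MatC n := - vecMulVec x (star e)
  have key := hneg (m + 1) (Fin.cons A0 A) (Fin.cons e f) (by
    rw [Fin.sum_univ_succ]
    simp [A0, neg_mulVec, vecMulVec_mulVec, he, ← hx])
  rw [Fin.sum_univ_succ] at key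
  simp only [Fin.sum_univ_succ, Fin.cons_zero, Fin.cons_succ, Finset.sum_add_distrib] at key
  rw [← formL_apply] at key
  have hL : ∑ i, star (f i) ⬝ᵥ (ψ ((A i)ᴴ * A0) *ᵥ e) = - formL A f (LinearMap.mulLeft ℂ G) := by
    rw [formL_apply, ← Finset.sum_neg_distrib]
    refine Finset.sum_congr rfl fun i _ => ?_
    have : (A i)ᴴ * A0 = - vecMulVec ((A i)ᴴ *ᵥ x) (star e) := by
      simp [A0, mul_vecMulVec]
    rw [this, map_neg, neg_mulVec, ← hG, dotProduct_neg, neg_inj, ← dotProduct_sum]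
    congr 1
    simp [hx, mulVec_sum, mulVec_mulVec]
  have hR : ∑ i, star e ⬝ᵥ (ψ (A0ᴴ * A i) *ᵥ f i)
      = - star (formL A f (LinearMap.mulLeft ℂ G)) := by
    rw [← star_neg, ← hL, star_sum]
    refine Finset.sum_congr rfl fun i _ => ?_
    rw [star_quad, ← hsa]
    simp
  have h00 : star e ⬝ᵥ (ψ (A0ᴴ * A0) *ᵥ e) = γ * (star x ⬝ᵥ x) := by
    have : A0ᴴ * A0 = (star x ⬝ᵥ x) • vecMulVec e (star e) := by
      simp [A0, conjTranspose_vecMulVec, vecMulVec_mul_vecMulVec, vecMulVec_smul]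
    rw [this, map_smul, smul_mulVec, dotProduct_smul, smul_eq_mul, mul_comm]
  rw [hL, hR, h00] at key
  rw [map_sub, map_sub, map_add, map_smul, formL_mulRight, formL_one, hγ, ← hx, smul_eq_mul,
    ← neg_nonpos]
  convert key using 1
  ring

theorem inv_isCP {ψ : Module.End ℂ (MatC n)} (hψ : IsCondNeg ψ) (hone : 1 ≤ ψ 1) {t : ℝ}
    (ht : 0 ≤ t) : ∃ R : Module.End ℂ (MatC n), (ψ + (t : ℂ) • 1) * R = 1 ∧ IsCP R := by
  obtain ⟨G, g, hΘ⟩ := lindblad hψ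
  set Θ := LinearMap.mulLeft ℂ G + LinearMap.mulRight ℂ Gᴴ - (g : ℂ) • 1 - ψ with hΘd
  obtain ⟨c, hc0, hct, hcG⟩ : ∃ c : ℝ, 0 < c ∧ 0 ≤ c - t + g ∧ ‖-G‖ * ‖(1 : MatC n)‖ < c := by
    refine ⟨max (max 1 (t - g)) (‖-G‖ * ‖(1 : MatC n)‖ + 1), ?_, ?_, ?_⟩
    · exact lt_of_lt_of_le one_pos ((le_max_left _ _).trans (le_max_left _ _))
    · have : t - g ≤ max (max 1 (t - g)) (‖-G‖ * ‖(1 : MatC n)‖ + 1) :=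
        (le_max_right _ _).trans (le_max_left _ _)
      linarith
    · exact lt_of_lt_of_le (lt_add_one _) (le_max_right _ _)
  have hBu : IsUnit ((c : ℂ) • (1 : MatC n) + G) := by
    have : (c : ℂ) ∈ resolventSet ℂ (-G) :=
      spectrum.mem_resolventSet_of_norm_lt_mul (by simpa [abs_of_pos hc0] using hcG)
    rw [spectrum.mem_resolventSet_iff, Algebra.algebraMap_eq_smul_one, sub_neg_eq_add] at this
    exact this
  set B : MatC n := (c : ℂ) • (1 : MatC n) + G with hB
  obtain ⟨B', hBB', hB'B⟩ : ∃ B' : MatC n, B * B' = 1 ∧ B' * B = 1 := by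
    obtain ⟨u, hu⟩ := hBu
    exact ⟨(↑u⁻¹ : MatC n), by rw [← hu]; simp, by rw [← hu]; simp⟩
  let Ad : MatC n → Module.End ℂ (MatC n) := fun X =>
    LinearMap.mulLeft ℂ X * LinearMap.mulRight ℂ Xᴴ
  have hAd : ∀ X a, Ad X a = X * (a * Xᴴ) := fun X a => rfl
  have hBh : Bᴴ * B'ᴴ = 1 := by rw [← conjTranspose_mul, hB'B, conjTranspose_one]
  have hBh' : B'ᴴ * Bᴴ = 1 := by rw [← conjTranspose_mul, hBB', conjTranspose_one]
  have hAd1 : Ad B * Ad B' = 1 := by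
    ext1 a
    change B * ((B' * (a * B'ᴴ)) * Bᴴ) = a
    calc _ = (B * B') * a * (B'ᴴ * Bᴴ) := by simp only [Matrix.mul_assoc]
      _ = a := by rw [hBB', hBh']; simp
  let Q : Module.End ℂ (MatC n) := (c : ℂ) • Θ + ((c * (c - t + g) : ℝ) : ℂ) • 1 + Ad G
  have hQ : IsCP Q := by
    refine ((hΘ.smul ?_).add (IsCP.one.smul ?_)).add (IsCP.conj G)
    · exact_mod_cast hc0.le
    · exact_mod_cast mul_nonneg hc0.le hct
  have hT : (c : ℂ) • (ψ + (t : ℂ) • 1) = Ad B - Q := by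
    ext1 a
    have hBt : Bᴴ = (c : ℂ) • (1 : MatC n) + Gᴴ := by simp [hB]
    simp only [Q, hΘd, hAd, LinearMap.sub_apply, LinearMap.add_apply, LinearMap.smul_apply,
      Module.End.one_apply, LinearMap.mulLeft_apply, LinearMap.mulRight_apply, hBt]
    rw [hB]
    simp only [Matrix.add_mul, Matrix.mul_add, Matrix.smul_mul, Matrix.mul_smul, Matrix.one_mul,
      Matrix.mul_one]
    push_cast
    module
  obtain ⟨N, hN0, hN⟩ : ∃ N : ℝ, 0 ≤ N ∧ B * Bᴴ ≤ N • (1 : MatC n) := by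
    refine ⟨‖B * Bᴴ‖, norm_nonneg _, ?_⟩
    have := IsSelfAdjoint.le_algebraMap_norm_self (a := B * Bᴴ) (IsSelfAdjoint.mul_star_self B)
    rwa [Algebra.algebraMap_eq_smul_one] at this
  set ε : ℝ := c / (N + c) with hε
  have hε0 : 0 < ε := by positivity
  have hε1 : ε ≤ 1 := by rw [hε, div_le_one (by positivity)]; linarith
  have hεN : ε * N ≤ c := by
    rw [hε, div_mul_eq_mul_div, div_le_iff₀ (by positivity)]
    nlinarith
  have hone0 : (0 : MatC n) ≤ 1 := zero_le_one
  have hQ1 : Q 1 ≤ (1 - ε) • (B * Bᴴ) := by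
    have e1 : Q 1 = B * Bᴴ - c • (ψ 1 + t • (1 : MatC n)) := by
      have := congrArg (fun φ : Module.End ℂ (MatC n) => φ 1) hT
      simp only [LinearMap.sub_apply, hAd, LinearMap.smul_apply, LinearMap.add_apply,
        Module.End.one_apply, Matrix.one_mul, Complex.coe_smul] at this
      rw [this]; abel
    have e2 : ε • (B * Bᴴ) ≤ c • (ψ 1 + t • (1 : MatC n)) := by
      calc ε • (B * Bᴴ) ≤ ε • (N • (1 : MatC n)) := smul_le_smul_of_nonneg_left hN hε0.le
        _ = (ε * N) • (1 : MatC n) := by rw [mul_smul]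
        _ ≤ c • (1 : MatC n) := smul_le_smul_of_nonneg_right hεN hone0
        _ ≤ c • (ψ 1 + t • (1 : MatC n)) := by
          refine smul_le_smul_of_nonneg_left ?_ hc0.le
          calc (1 : MatC n) ≤ ψ 1 := hone
            _ ≤ _ := le_add_of_nonneg_right (smul_nonneg ht hone0)
    rw [e1, sub_smul, one_smul]
    exact sub_le_sub_left e2 _
  have hS : IsCP (Ad B' * Q) := (IsCP.conj B').mul hQ
  have hS1 : (Ad B' * Q) 1 ≤ (1 - ε) • (1 : MatC n) := by
    have := star_right_conjugate_le_conjugate hQ1 B'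
    rw [Matrix.star_eq_conjTranspose] at this
    have e : B' * ((1 - ε) • (B * Bᴴ)) * B'ᴴ = (1 - ε) • (1 : MatC n) := by
      rw [Matrix.mul_smul, Matrix.smul_mul]
      congr 1
      calc _ = (B' * B) * (Bᴴ * B'ᴴ) := by simp only [Matrix.mul_assoc]
        _ = 1 := by rw [hB'B, hBh, Matrix.one_mul]
    rw [e, Matrix.mul_assoc] at this
    exact this
  obtain ⟨R, hR1, -, hR⟩ := neumann hS (by linarith) (by linarith) hS1
  refine ⟨(c : ℂ) • (R * Ad B'), ?_, ((hR.mul (IsCP.conj B')).smul (by exact_mod_cast hc0.le))⟩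
  rw [mul_smul_comm, ← smul_mul_assoc, hT]
  have : Ad B - Q = Ad B * (1 - Ad B' * Q) := by
    rw [mul_sub, mul_one, ← mul_assoc, hAd1, one_mul]
  rw [this, mul_assoc, ← mul_assoc _ R, hR1, one_mul, hAd1]

theorem qRes_spec {φ : Module.End ℂ (MatC n)} (hu : IsUnit φ) (hn : NoNegEig φ) {t : ℝ}
    (ht : 0 ≤ t) : (Ring.inverse φ + (t : ℂ) • 1) * qRes φ t = 1 := by
  have hU : IsUnit (1 + (t : ℂ) • φ) := by
    rw [LinearMap.isUnit_iff_ker_eq_bot, LinearMap.ker_eq_bot']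
    intro x hx
    by_contra hx0
    obtain rfl | htp := ht.eq_or_lt
    · simp at hx; exact hx0 hx
    apply hn (-(1 / t)) (by simpa using htp)
    refine Module.End.hasEigenvalue_of_hasEigenvector (x := x) ⟨?_, hx0⟩
    rw [Module.End.mem_eigenspace_iff]
    have h1 : x + (t : ℂ) • φ x = 0 := hx
    have h2 : (t : ℂ) ≠ 0 := by exact_mod_cast htp.ne'
    have h3 : (t : ℂ) • φ x = - x := by rw [eq_neg_iff_add_eq_zero, add_comm]; exact h1
    calc φ x = (t : ℂ)⁻¹ • ((t : ℂ) • φ x) := by rw [smul_smul, inv_mul_cancel₀ h2, one_smul]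
      _ = _ := by rw [h3]; push_cast; simp
  have e : (Ring.inverse φ + (t : ℂ) • 1) * φ = 1 + (t : ℂ) • φ := by
    rw [add_mul, Ring.inverse_mul_cancel _ hu, smul_mul_assoc, one_mul]
  rw [qRes, ← mul_assoc, e, Ring.mul_inverse_cancel _ hU]

theorem tendsto_res {ψ : Module.End ℂ (MatC n)} {R : ℝ → Module.End ℂ (MatC n)}
    (hR : ∀ t : ℝ, 0 ≤ t → (ψ + (t : ℂ) • 1) * R t = 1) (X : MatC n) :
    Tendsto (fun t : ℝ => ((t : ℂ) • 1 - ((t : ℂ) ^ 2) • R t) X) atTop (𝓝 (ψ X)) := by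
  let E := Module.End.toContinuousLinearMap (𝕜 := ℂ) (MatC n)
  have h1 : Tendsto (fun t : ℝ => Ring.inverse (1 + ((t : ℂ)⁻¹) • E ψ)) atTop (𝓝 1) := by
    have hc := NormedRing.inverse_continuousAt (R := MatC n →L[ℂ] MatC n) 1
    have h0 : Tendsto (fun t : ℝ => 1 + ((t : ℂ)⁻¹) • E ψ) atTop (𝓝 1) := by
      have hi : Tendsto (fun t : ℝ => ((t : ℂ)⁻¹)) atTop (𝓝 0) := by
        have := (Complex.continuous_ofReal.tendsto 0).comp tendsto_inv_atTop_zero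
        simpa [Function.comp_def] using this
      simpa using tendsto_const_nhds.add (hi.smul_const (E ψ))
    have := hc.tendsto.comp (by simpa using h0)
    simpa [Function.comp_def] using this
  have h2 : Tendsto (fun t : ℝ => ((t : ℂ) • R t) X) atTop (𝓝 X) := by
    have h3 : Tendsto (fun t : ℝ => (Ring.inverse (1 + ((t : ℂ)⁻¹) • E ψ)) X) atTop (𝓝 X) :=
      ((ContinuousLinearMap.apply ℂ (MatC n) X).continuous.tendsto _).comp h1
    refine h3.congr' ?_
    filter_upwards [eventually_gt_atTop 0] with t ht
    have htc : (t : ℂ) ≠ 0 := by exact_mod_cast ht.ne'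
    have e1 : (1 + ((t : ℂ)⁻¹) • ψ) * ((t : ℂ) • R t) = 1 := by
      refine Eq.trans ?_ (hR t ht.le)
      rw [mul_smul_comm, ← smul_mul_assoc, smul_add, smul_smul,
        mul_inv_cancel₀ htc, one_smul, add_comm]
    have e2 : ((t : ℂ) • R t) * (1 + ((t : ℂ)⁻¹) • ψ) = 1 := mul_eq_one_comm.1 e1
    have f1 : (1 + ((t : ℂ)⁻¹) • E ψ) * E ((t : ℂ) • R t) = 1 := by
      have := congrArg E e1
      simpa only [map_mul, map_add, map_smul, map_one] using this
    have f2 : E ((t : ℂ) • R t) * (1 + ((t : ℂ)⁻¹) • E ψ) = 1 := by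
      have := congrArg E e2
      simpa only [map_mul, map_add, map_smul, map_one] using this
    have := Ring.inverse_unit (⟨_, _, f1, f2⟩ : (MatC n →L[ℂ] MatC n)ˣ)
    simp only [Units.inv_mk] at this
    rw [this]
    rfl
  have hc : Continuous ψ := LinearMap.continuous_of_finiteDimensional _
  refine ((hc.tendsto X).comp h2).congr' ?_
  filter_upwards [eventually_ge_atTop 0] with t ht
  have e := hR t ht
  have : (t : ℂ) • 1 - ((t : ℂ) ^ 2) • R t = ψ * ((t : ℂ) • R t) := by
    rw [← e, add_mul, smul_mul_assoc, one_mul, mul_smul_comm]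
    module
  rw [this]
  rfl

theorem forward {φ₁ φ₂ : Module.End ℂ (MatC n)}
    (h1 : IsUnit φ₁) (hq : IsQPos φ₁) (h2 : IsUnit φ₂) (hle : qLE φ₂ φ₁) (hq2 : IsQPos φ₂) :
    IsCondNeg (Ring.inverse φ₂) ∧ IsCP (Ring.inverse φ₂ - Ring.inverse φ₁) := by
  have s1 := fun (t : ℝ) (ht : 0 ≤ t) => qRes_spec h1 hq.1 ht
  have s2 := fun (t : ℝ) (ht : 0 ≤ t) => qRes_spec h2 hq2.1 ht
  refine ⟨⟨?_, ?_⟩, ?_⟩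
  · have hcp : IsCP φ₂ := by
      have := hq2.2 0 le_rfl
      simpa [qRes] using this
    intro a
    have hsa := hcp.selfAdj
    have inj : Function.Injective φ₂ :=
      LinearMap.ker_eq_bot.1 ((LinearMap.isUnit_iff_ker_eq_bot _).1 h2)
    have hm : ∀ x, φ₂ (Ring.inverse φ₂ x) = x := fun x => by
      rw [← Module.End.mul_apply, Ring.mul_inverse_cancel _ h2, Module.End.one_apply]
    apply inj
    rw [hsa, hm, hm]
  · intro m A f hAf
    have := tendsto_formL A f (tendsto_res s2)
    refine le_of_tendsto this ?_
    filter_upwards [eventually_ge_atTop 0] with t ht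
    rw [map_sub, map_smul, map_smul, formL_one, hAf]
    have h0 : 0 ≤ formL A f (qRes φ₂ t) := hq2.2 t ht m A f
    have ht2 : (0 : ℂ) ≤ (t : ℂ) ^ 2 := by exact_mod_cast sq_nonneg t
    simpa using mul_nonneg ht2 h0
  · refine IsCP.of_tendsto (l := atTop) (φ := fun t : ℝ =>
      ((t : ℂ) • 1 - ((t : ℂ) ^ 2) • qRes φ₂ t) - ((t : ℂ) • 1 - ((t : ℂ) ^ 2) • qRes φ₁ t)) ?_ ?_
    · intro X
      exact (tendsto_res s2 X).sub (tendsto_res s1 X)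
    · filter_upwards [eventually_ge_atTop 0] with t ht
      have ht2 : (0 : ℂ) ≤ (t : ℂ) ^ 2 := by exact_mod_cast sq_nonneg t
      have := (hle t ht).smul ht2
      convert this using 1
      module

theorem backward {φ₁ φ₂ : Module.End ℂ (MatC n)}
    (h1 : IsUnit φ₁) (hone : φ₁ 1 = 1) (hq : IsQPos φ₁) (h2 : IsUnit φ₂)
    (hcn : IsCondNeg (Ring.inverse φ₂)) (hD : IsCP (Ring.inverse φ₂ - Ring.inverse φ₁)) :
    qLE φ₂ φ₁ ∧ IsQPos φ₂ := by
  have hψ1 : Ring.inverse φ₁ 1 = 1 := by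
    conv_lhs => rw [← hone]
    rw [← Module.End.mul_apply, Ring.inverse_mul_cancel _ h1, Module.End.one_apply]
  have hge : 1 ≤ Ring.inverse φ₂ 1 := by
    have := hD.nonneg (zero_le_one (α := MatC n))
    rwa [LinearMap.sub_apply, hψ1, sub_nonneg] at this
  have hinv := fun (t : ℝ) (ht : 0 ≤ t) => inv_isCP hcn hge ht
  have hnn : NoNegEig φ₂ := by
    intro r hr hev
    obtain ⟨x, hx⟩ := hev.exists_hasEigenvector
    have hx1 : φ₂ x = (r : ℂ) • x := hx.apply_eq_smul
    have hrc : (r : ℂ) ≠ 0 := by exact_mod_cast hr.ne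
    obtain ⟨R, hR, -⟩ := hinv (-r⁻¹) (by simpa using hr.le)
    have hR' := mul_eq_one_comm.1 hR
    apply hx.2
    have hx2 : x = (r : ℂ) • Ring.inverse φ₂ x := by
      rw [← map_smul, ← hx1, ← Module.End.mul_apply, Ring.inverse_mul_cancel _ h2,
        Module.End.one_apply]
    have hx3 : Ring.inverse φ₂ x = (r : ℂ)⁻¹ • x := by
      conv_rhs => rw [hx2]
      rw [smul_smul, inv_mul_cancel₀ hrc, one_smul]
    have hx4 : (Ring.inverse φ₂ + ((-r⁻¹ : ℝ) : ℂ) • 1) x = 0 := by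
      rw [LinearMap.add_apply, hx3]
      simp
    calc x = (R * (Ring.inverse φ₂ + ((-r⁻¹ : ℝ) : ℂ) • 1)) x := by rw [hR']; rfl
      _ = 0 := by rw [Module.End.mul_apply, hx4, map_zero]
  have hcp2 : ∀ t : ℝ, 0 ≤ t → IsCP (qRes φ₂ t) := by
    intro t ht
    obtain ⟨R, hR, hRcp⟩ := hinv t ht
    have e := qRes_spec h2 hnn ht
    have : qRes φ₂ t = R := by
      rw [← one_mul (qRes φ₂ t), ← mul_eq_one_comm.1 hR, mul_assoc, e, mul_one]
    rwa [this]
  refine ⟨?_, hnn, hcp2⟩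
  intro t ht
  have e1 := mul_eq_one_comm.1 (qRes_spec h1 hq.1 ht)
  have e2 := qRes_spec h2 hnn ht
  have : qRes φ₁ t - qRes φ₂ t
      = qRes φ₁ t * (Ring.inverse φ₂ - Ring.inverse φ₁) * qRes φ₂ t := by
    have : Ring.inverse φ₂ - Ring.inverse φ₁
        = (Ring.inverse φ₂ + (t : ℂ) • 1) - (Ring.inverse φ₁ + (t : ℂ) • 1) := by abel
    rw [this, mul_sub, sub_mul, e1, one_mul, mul_assoc, e2, mul_one]
  rw [this]
  exact ((hq.2 t ht).mul hD).mul (hcp2 t ht)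

end helpers

/-- For `φ₁` invertible unital q-positive and `φ₂` linear invertible:
`φ₁ ≥_q φ₂ ≥_q 0` iff `φ₂⁻¹` is conditionally negative and `φ₂⁻¹ − φ₁⁻¹` is
completely positive. -/
theorem stmt11 {n : ℕ} (φ₁ φ₂ : Module.End ℂ (MatC n))
    (h1 : IsUnit φ₁) (hone : φ₁ 1 = 1) (hq : IsQPos φ₁) (h2 : IsUnit φ₂) :
    (qLE φ₂ φ₁ ∧ IsQPos φ₂) ↔
      (IsCondNeg (Ring.inverse φ₂) ∧ IsCP (Ring.inverse φ₂ - Ring.inverse φ₁)) := by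
  exact ⟨fun h => forward h1 hq h2 h.1 h.2, fun h => backward h1 hone hq h2 h.1 h.2⟩
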